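/- arXiv:2507.17935 — 2 statements merged into one kernel-verified Lean document; each statement's English description precedes it below -/
import Mathlib

section
/- Let I, J ⊂ S be two nonzero proper monomial ideals, and set r = slength(I), r̄ = slength(S/I), s = slength(J), s̄ = slength(S/J). Then: (1) slength(I ∩ J) ≤ r·s; (2) slength(I + J) ≤ min{r + s·r̄, s + r·s̄}; (3) slength(S/(I + J)) ≤ r̄·s̄; (4) slength(S/(I ∩ J)) ≤ min{r̄ + r·s̄, s̄ + s·r̄}. -/
open MvPolynomial

/-- The set of exponent vectors of the monomials in the Stanley space `x^u · K[Z]`. -/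
def stanleySet {σ : Type} (u : σ →₀ ℕ) (Z : Set σ) : Set (σ →₀ ℕ) :=
  {w | ∃ v : σ →₀ ℕ, ↑v.support ⊆ Z ∧ w = u + v}

/-- A Stanley decomposition (partition into Stanley spaces) of a set `P` of
exponent vectors of monomials.  By the standard correspondence, Stanley
decompositions of a multigraded `K`-vector subquotient of `S` spanned by the
monomials with exponents in `P` correspond exactly to such partitions. -/
structure StanleyPartition {σ : Type} (P : Set (σ →₀ ℕ)) where
  r : ℕ
  base : Fin r → σ →₀ ℕ
  vars : Fin r → Set σ
  cover : P = ⋃ i, stanleySet (base i) (vars i)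
  disj : ∀ i j, i ≠ j → Disjoint (stanleySet (base i) (vars i)) (stanleySet (base j) (vars j))

/-- The Stanley length of `P`: the minimal length of a Stanley decomposition. -/
noncomputable def slength {σ : Type} (P : Set (σ →₀ ℕ)) : ℕ :=
  sInf {r | ∃ D : StanleyPartition P, D.r = r}

/-- The set of exponent vectors of the monomials belonging to an ideal. -/
def monSet {σ K : Type} [Field K] (I : Ideal (MvPolynomial σ K)) : Set (σ →₀ ℕ) :=
  {d | (monomial d (1 : K) : MvPolynomial σ K) ∈ I}

/-- `I` is a monomial ideal. -/
def IsMonomialIdeal {σ K : Type} [Field K] (I : Ideal (MvPolynomial σ K)) : Prop :=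
  ∃ A : Set (σ →₀ ℕ), I = Ideal.span ((fun d => (monomial d (1 : K) : MvPolynomial σ K)) '' A)

/-- Exponent vectors of the minimal monomial generators of `I`. -/
def minGens {σ K : Type} [Field K] (I : Ideal (MvPolynomial σ K)) : Set (σ →₀ ℕ) :=
  {d | d ∈ monSet I ∧ ∀ e ∈ monSet I, e ≤ d → e = d}

theorem mem_stanleySet_iff {σ : Type} {u w : σ →₀ ℕ} {Z : Set σ} :
    w ∈ stanleySet u Z ↔ u ≤ w ∧ ∀ i ∉ Z, w i = u i := by
  constructor
  · rintro ⟨v, hv, rfl⟩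
    refine ⟨le_self_add, fun i hi => ?_⟩
    have : v i = 0 := by
      by_contra h
      exact hi (hv (by simpa using h))
    simp [this]
  · rintro ⟨hle, heq⟩
    refine ⟨w - u, fun i hi => ?_, (add_tsub_cancel_of_le hle).symm⟩
    by_contra h
    simp [heq i h] at hi

theorem stanleySet_inter_stanleySet {σ : Type} (u u' : σ →₀ ℕ) (Z Z' : Set σ)
    (h : (stanleySet u Z ∩ stanleySet u' Z').Nonempty) :
    stanleySet u Z ∩ stanleySet u' Z' = stanleySet (u ⊔ u') (Z ∩ Z') := by
  obtain ⟨w₀, h₁, h₂⟩ := h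
  rw [mem_stanleySet_iff] at h₁ h₂
  ext w
  simp only [Set.mem_inter_iff, mem_stanleySet_iff, sup_le_iff, Finsupp.sup_apply]
  constructor
  · rintro ⟨⟨ha, hb⟩, hc, hd⟩
    refine ⟨⟨ha, hc⟩, fun i hi => ?_⟩
    have := ha i
    have := hc i
    by_cases hZ : i ∈ Z
    · have := hd i fun hZ' => hi ⟨hZ, hZ'⟩
      omega
    · have := hb i hZ
      omega
  · rintro ⟨⟨ha, hc⟩, hb⟩
    refine ⟨⟨ha, fun i hi => ?_⟩, hc, fun i hi => ?_⟩
    · have := hb i fun h => hi h.1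
      have := h₁.2 i hi
      have := h₂.1 i
      omega
    · have := hb i fun h => hi h.2
      have := h₂.2 i hi
      have := h₁.1 i
      omega

/-- A finite disjoint family of sets, each empty or a Stanley space, yields a Stanley partition
of its union. -/
theorem StanleyPartition.exists_of_family {σ ι : Type} [Finite ι] {P : Set (σ →₀ ℕ)}
    (f : ι → Set (σ →₀ ℕ)) (hf : ∀ i, (f i).Nonempty → ∃ u Z, f i = stanleySet u Z)
    (hcover : P = ⋃ i, f i) (hdisj : Pairwise (Function.onFun Disjoint f)) :
    ∃ D : StanleyPartition P, D.r ≤ Nat.card ι := by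
  choose u Z huZ using hf
  let e := Finite.equivFin {i // (f i).Nonempty}
  have he : ∀ k, stanleySet (u _ (e.symm k).2) (Z _ (e.symm k).2) = f (e.symm k) :=
    fun k => (huZ _ _).symm
  refine ⟨⟨Nat.card {i // (f i).Nonempty}, fun k => u _ (e.symm k).2,
    fun k => Z _ (e.symm k).2, ?_, fun k l hkl => ?_⟩, Finite.card_subtype_le _⟩
  · simp only [he]
    rw [hcover, e.symm.surjective.iUnion_comp (fun x : {i // (f i).Nonempty} => f x)]
    ext w
    simp only [Set.mem_iUnion]
    exact ⟨fun ⟨i, hi⟩ => ⟨⟨i, w, hi⟩, hi⟩, fun ⟨i, hi⟩ => ⟨i, hi⟩⟩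
  · simp only [he]
    exact hdisj fun h => hkl (e.symm.injective (Subtype.ext h))

theorem StanleyPartition.slength_le {σ : Type} {P : Set (σ →₀ ℕ)} (D : StanleyPartition P) :
    slength P ≤ D.r :=
  Nat.sInf_le ⟨D, rfl⟩

theorem StanleyPartition.exists_r_eq_slength {σ : Type} {P : Set (σ →₀ ℕ)}
    (h : Nonempty (StanleyPartition P)) : ∃ D : StanleyPartition P, D.r = slength P :=
  Nat.sInf_mem (s := {r | ∃ D : StanleyPartition P, D.r = r}) (h.elim fun D => ⟨D.r, D, rfl⟩)

theorem StanleyPartition.exists_inter {σ : Type} {P Q : Set (σ →₀ ℕ)}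
    (hP : Nonempty (StanleyPartition P)) (hQ : Nonempty (StanleyPartition Q)) :
    ∃ D : StanleyPartition (P ∩ Q), D.r ≤ slength P * slength Q := by
  obtain ⟨D, hD⟩ := exists_r_eq_slength hP
  obtain ⟨E, hE⟩ := exists_r_eq_slength hQ
  have := exists_of_family (P := P ∩ Q)
    (fun x : Fin D.r × Fin E.r =>
      stanleySet (D.base x.1) (D.vars x.1) ∩ stanleySet (E.base x.2) (E.vars x.2))
    (fun x hx => ⟨_, _, stanleySet_inter_stanleySet _ _ _ _ hx⟩)
    (by
      conv_lhs => rw [D.cover, E.cover]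
      rw [Set.iUnion_inter_iUnion, Set.iUnion_prod'])
    (by
      rintro ⟨a, b⟩ ⟨c, d⟩ h
      by_cases hac : a = c
      · have hbd : b ≠ d := fun hbd => h (by rw [hac, hbd])
        exact (E.disj b d hbd).mono Set.inter_subset_right Set.inter_subset_right
      · exact (D.disj a c hac).mono Set.inter_subset_left Set.inter_subset_left)
  simpa [hD, hE] using this

theorem StanleyPartition.exists_union {σ : Type} {P Q : Set (σ →₀ ℕ)} (h : Disjoint P Q)
    (hP : Nonempty (StanleyPartition P)) (hQ : Nonempty (StanleyPartition Q)) :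
    ∃ D : StanleyPartition (P ∪ Q), D.r ≤ slength P + slength Q := by
  obtain ⟨D, hD⟩ := exists_r_eq_slength hP
  obtain ⟨E, hE⟩ := exists_r_eq_slength hQ
  have hDP (i) : stanleySet (D.base i) (D.vars i) ⊆ P := by
    conv_rhs => rw [D.cover]
    exact Set.subset_iUnion (fun i => stanleySet (D.base i) (D.vars i)) i
  have hEQ (i) : stanleySet (E.base i) (E.vars i) ⊆ Q := by
    conv_rhs => rw [E.cover]
    exact Set.subset_iUnion (fun i => stanleySet (E.base i) (E.vars i)) i
  have := exists_of_family (P := P ∪ Q)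
    (Sum.elim (fun i : Fin D.r => stanleySet (D.base i) (D.vars i))
      (fun i : Fin E.r => stanleySet (E.base i) (E.vars i)))
    (by rintro (i | i) - <;> exact ⟨_, _, rfl⟩)
    (by
      rw [Set.iUnion_sum]
      conv_lhs => rw [D.cover, E.cover]
      rfl)
    (by
      rintro (i | i) (j | j) hij
      · exact D.disj i j fun h => hij (by rw [h])
      · exact h.mono (hDP i) (hEQ j)
      · exact h.symm.mono (hEQ i) (hDP j)
      · exact E.disj i j fun h => hij (by rw [h]))
  simpa [hD, hE] using this

theorem slength_inter_le {σ : Type} {P Q : Set (σ →₀ ℕ)}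
    (hP : Nonempty (StanleyPartition P)) (hQ : Nonempty (StanleyPartition Q)) :
    slength (P ∩ Q) ≤ slength P * slength Q :=
  let ⟨D, hD⟩ := StanleyPartition.exists_inter hP hQ
  D.slength_le.trans hD

/-- Writing `P ∪ Q` as the disjoint union of `P` and `Q ∩ Pᶜ` bounds its Stanley length. -/
theorem slength_union_le {σ : Type} {P Q : Set (σ →₀ ℕ)}
    (hP : Nonempty (StanleyPartition P)) (hQ : Nonempty (StanleyPartition Q))
    (hP' : Nonempty (StanleyPartition Pᶜ)) :
    slength (P ∪ Q) ≤ slength P + slength Q * slength Pᶜ := by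
  obtain ⟨E, -⟩ := StanleyPartition.exists_inter hQ hP'
  obtain ⟨D, hD⟩ := StanleyPartition.exists_union
    (disjoint_compl_right.mono_right Set.inter_subset_right) hP ⟨E⟩
  rw [show P ∪ Q = P ∪ Q ∩ Pᶜ by rw [← Set.sdiff_eq, Set.union_sdiff_self]]
  exact D.slength_le.trans (hD.trans (Nat.add_le_add_left (slength_inter_le hQ hP') _))

/-- A set of exponent vectors whose membership only depends on the exponents truncated at `N`
has a Stanley partition. -/
theorem StanleyPartition.nonempty_of_truncation {σ : Type} [Finite σ] {P : Set (σ →₀ ℕ)}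
    (N : σ →₀ ℕ) (hN : ∀ w, w ⊓ N ∈ P ↔ w ∈ P) : Nonempty (StanleyPartition P) := by
  have hIic : (Set.Iic N).Finite := by
    classical
    rw [← Set.Icc_bot]
    exact Set.finite_Icc _ _
  have hfin : Finite {c // c ∈ Set.Iic N ∩ P} := (hIic.inter_of_left P).to_subtype
  have key (c : {c // c ∈ Set.Iic N ∩ P}) :
      {w | w ⊓ N = c} = stanleySet (c : σ →₀ ℕ) {i | N i ≤ (c : σ →₀ ℕ) i} := by
    ext w
    have hc : ∀ i, (c : σ →₀ ℕ) i ≤ N i := c.2.1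
    simp only [Set.mem_ofPred_eq, mem_stanleySet_iff, Finsupp.ext_iff, Finsupp.inf_apply,
      Finsupp.le_def]
    constructor
    · intro h
      exact ⟨fun i => by have := h i; omega, fun i hi => by have := h i; omega⟩
    · rintro ⟨h₁, h₂⟩ i
      have := h₁ i
      have := hc i
      by_cases hi : N i ≤ (c : σ →₀ ℕ) i
      · omega
      · have := h₂ i hi
        omega
  obtain ⟨D, -⟩ := exists_of_family (P := P)
    (fun c : {c // c ∈ Set.Iic N ∩ P} => {w | w ⊓ N = c})
    (fun c _ => ⟨_, _, key c⟩)
    (by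
      ext w
      simp only [Set.mem_iUnion, Set.mem_ofPred_eq]
      constructor
      · intro hw
        exact ⟨⟨w ⊓ N, Set.mem_Iic.2 inf_le_right, (hN w).2 hw⟩, rfl⟩
      · rintro ⟨c, hc⟩
        exact (hN w).1 (hc ▸ c.2.2))
    (fun c d hcd => Set.disjoint_left.2 fun w hc hd => hcd (Subtype.ext (hc.symm.trans hd)))
  exact ⟨D⟩

theorem IsUpperSet.exists_truncation {σ : Type} [Finite σ] {P : Set (σ →₀ ℕ)}
    (hP : IsUpperSet P) : ∃ N : σ →₀ ℕ, ∀ w, w ⊓ N ∈ P ↔ w ∈ P := by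
  have hfin : {d | Minimal (· ∈ P) d}.Finite :=
    WellQuasiOrderedLE.finite_of_isAntichain (setOfPred_minimal_antichain _)
  obtain ⟨N, hN⟩ := hfin.bddAbove
  refine ⟨N, fun w => ⟨fun h => hP inf_le_left h, fun h => ?_⟩⟩
  obtain ⟨m, hmw, hm⟩ := exists_minimal_le_of_wellFoundedLT (· ∈ P) w h
  exact hP (le_inf hmw (hN hm)) hm.prop

theorem IsUpperSet.nonempty_stanleyPartition {σ : Type} [Finite σ] {P : Set (σ →₀ ℕ)}
    (hP : IsUpperSet P) : Nonempty (StanleyPartition P) :=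
  let ⟨N, hN⟩ := hP.exists_truncation
  StanleyPartition.nonempty_of_truncation N hN

theorem IsUpperSet.nonempty_stanleyPartition_compl {σ : Type} [Finite σ] {P : Set (σ →₀ ℕ)}
    (hP : IsUpperSet P) : Nonempty (StanleyPartition Pᶜ) :=
  let ⟨N, hN⟩ := hP.exists_truncation
  StanleyPartition.nonempty_of_truncation N fun w => not_congr (hN w)

theorem isUpperSet_monSet {σ K : Type} [Field K] (I : Ideal (MvPolynomial σ K)) :
    IsUpperSet (monSet I) := by
  intro a b hab ha
  have := I.mul_mem_left (monomial (b - a) (1 : K)) ha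
  rwa [monomial_mul, one_mul, tsub_add_cancel_of_le hab] at this

theorem monSet_span {σ K : Type} [Field K] (A : Set (σ →₀ ℕ)) :
    monSet (Ideal.span ((fun d => (monomial d (1 : K) : MvPolynomial σ K)) '' A)) =
      {d | ∃ a ∈ A, a ≤ d} := by
  classical
  ext d
  simp [monSet, mem_ideal_span_monomial_image, support_monomial]

theorem monSet_inf {σ K : Type} [Field K] (I J : Ideal (MvPolynomial σ K)) :
    monSet (I ⊓ J) = monSet I ∩ monSet J :=
  rfl

theorem monSet_sup {σ K : Type} [Field K] {I J : Ideal (MvPolynomial σ K)}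
    (hI : IsMonomialIdeal I) (hJ : IsMonomialIdeal J) :
    monSet (I ⊔ J) = monSet I ∪ monSet J := by
  obtain ⟨A, rfl⟩ := hI
  obtain ⟨B, rfl⟩ := hJ
  rw [← Ideal.span_union, ← Set.image_union]
  simp only [monSet_span]
  ext d
  simp [or_and_right, exists_or]

/-- Bounds for the Stanley lengths of `I ∩ J`, `I + J`,
`S/(I + J)` and `S/(I ∩ J)` in terms of `r = slength(I)`, `r̄ = slength(S/I)`,
`s = slength(J)`, `s̄ = slength(S/J)`. -/
theorem stmt_5 {K : Type} [Field K] {n : ℕ} (I J : Ideal (MvPolynomial (Fin n) K))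
    (hmonI : IsMonomialIdeal I) (hmonJ : IsMonomialIdeal J)
    (hI0 : I ≠ ⊥) (hI1 : I ≠ ⊤) (hJ0 : J ≠ ⊥) (hJ1 : J ≠ ⊤) :
    slength (monSet (I ⊓ J)) ≤ slength (monSet I) * slength (monSet J) ∧
    slength (monSet (I ⊔ J)) ≤
      min (slength (monSet I) + slength (monSet J) * slength ((monSet I)ᶜ))
          (slength (monSet J) + slength (monSet I) * slength ((monSet J)ᶜ)) ∧
    slength ((monSet (I ⊔ J))ᶜ) ≤ slength ((monSet I)ᶜ) * slength ((monSet J)ᶜ) ∧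
    slength ((monSet (I ⊓ J))ᶜ) ≤
      min (slength ((monSet I)ᶜ) + slength (monSet I) * slength ((monSet J)ᶜ))
          (slength ((monSet J)ᶜ) + slength (monSet J) * slength ((monSet I)ᶜ)) := by
  have hI := (isUpperSet_monSet I).nonempty_stanleyPartition
  have hI' := (isUpperSet_monSet I).nonempty_stanleyPartition_compl
  have hJ := (isUpperSet_monSet J).nonempty_stanleyPartition
  have hJ' := (isUpperSet_monSet J).nonempty_stanleyPartition_compl
  rw [monSet_sup hmonI hmonJ, monSet_inf, Set.compl_union, Set.compl_inter]
  refine ⟨slength_inter_le hI hJ, le_min (slength_union_le hI hJ hI') ?_,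
    slength_inter_le hI' hJ', le_min ?_ ?_⟩
  · rw [Set.union_comm]
    exact slength_union_le hJ hI hJ'
  · have := slength_union_le hI' hJ' (by rwa [compl_compl])
    rwa [compl_compl, mul_comm] at this
  · rw [Set.union_comm]
    have := slength_union_le hJ' hI' (by rwa [compl_compl])
    rwa [compl_compl, mul_comm] at this
end

section
/- Let I ⊂ S be a monomial ideal minimally generated by m monomials, with G(I) = {u_1,…,u_m}, and set I_j = (u_1,…,u_j) for 1 ≤ j ≤ m. Then the following are equivalent: (1) the ordering u_1 ≤ u_2 ≤ ⋯ ≤ u_m is a linear quotients order for I, i.e., for every 2 ≤ j ≤ m, the colon ideal (u_1,…,u_{j−1}) : u_j is generated by a subset of the variables; (2) there exist subsets Z_1,…,Z_m ⊆ {x_1,…,x_n} such that for all 1 ≤ j ≤ m, the ideal I_j has the Stanley decomposition I_j = u_1K[Z_1] ⊕ u_2K[Z_2] ⊕ ⋯ ⊕ u_jK[Z_j]. -/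
open MvPolynomial

theorem add_mem_stanleySet_iff {σ : Type} (u w : σ →₀ ℕ) (Z : Set σ) :
    u + w ∈ stanleySet u Z ↔ ↑w.support ⊆ Z :=
  ⟨fun ⟨_, hv, h⟩ => add_left_cancel h ▸ hv, fun h => ⟨w, h, rfl⟩⟩

theorem le_of_mem_stanleySet {σ : Type} {u w : σ →₀ ℕ} {Z : Set σ}
    (h : w ∈ stanleySet u Z) : u ≤ w := by
  obtain ⟨v, -, rfl⟩ := h
  exact le_self_add

theorem mem_monSet_span_iff {σ K ι : Type} [Field K] (u : ι → (σ →₀ ℕ)) (s : Set ι)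
    (w : σ →₀ ℕ) :
    w ∈ monSet (Ideal.span ((fun i => (monomial (u i) (1 : K) : MvPolynomial σ K)) '' s)) ↔
      ∃ i ∈ s, u i ≤ w := by
  classical
  have himg : (fun i => (monomial (u i) (1 : K) : MvPolynomial σ K)) '' s =
      (fun d => (monomial d (1 : K) : MvPolynomial σ K)) '' (u '' s) := by
    rw [Set.image_image]
  rw [monSet, Set.mem_ofPred_eq, himg, mem_ideal_span_monomial_image]
  simp [support_monomial]

/-- The colon ideal of a monomial ideal by a monomial is generated by the variables in `V` iff
this holds at the level of exponent vectors. -/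
theorem colon_monomial_eq_span_X_iff {σ K ι : Type} [Field K] (u : ι → (σ →₀ ℕ)) (s : Set ι)
    (a : σ →₀ ℕ) (V : Set σ) :
    Submodule.colon
        (Ideal.span ((fun i => (monomial (u i) (1 : K) : MvPolynomial σ K)) '' s))
        (Ideal.span {(monomial a (1 : K) : MvPolynomial σ K)}) =
      Ideal.span ((fun k => (X k : MvPolynomial σ K)) '' V) ↔
    ∀ w : σ →₀ ℕ, (∃ i ∈ s, u i ≤ a + w) ↔ ∃ k ∈ V, w k ≠ 0 := by
  classical
  have himg : (fun i => (monomial (u i) (1 : K) : MvPolynomial σ K)) '' s =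
      (fun d => (monomial d (1 : K) : MvPolynomial σ K)) '' (u '' s) := by
    rw [Set.image_image]
  have hcolon : ∀ f : MvPolynomial σ K, f ∈ Submodule.colon
        (Ideal.span ((fun i => (monomial (u i) (1 : K) : MvPolynomial σ K)) '' s))
        (Ideal.span {(monomial a (1 : K) : MvPolynomial σ K)} : Ideal (MvPolynomial σ K)) ↔
      ∀ w ∈ f.support, ∃ i ∈ s, u i ≤ a + w := by
    intro f
    rw [Ideal.mem_colon_span_singleton, himg, mem_ideal_span_monomial_image]
    constructor
    · intro h w hw
      obtain ⟨_, ⟨i, hi, rfl⟩, hle⟩ := h (w + a) (by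
        rw [mem_support_iff, coeff_mul_monomial, mul_one]
        exact mem_support_iff.1 hw)
      exact ⟨i, hi, add_comm w a ▸ hle⟩
    · intro h x hx
      rw [mem_support_iff, coeff_mul_monomial'] at hx
      split_ifs at hx with hax
      · obtain ⟨i, hi, hle⟩ := h (x - a) (mem_support_iff.2 (by simpa using hx))
        exact ⟨u i, ⟨i, hi, rfl⟩, by rwa [add_tsub_cancel_of_le hax] at hle⟩
      · exact absurd rfl hx
  constructor
  · intro h w
    have hw := SetLike.ext_iff.1 h (monomial w (1 : K))
    rw [hcolon, mem_ideal_span_X_image] at hw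
    simpa [support_monomial] using hw
  · intro h
    ext f
    rw [hcolon, mem_ideal_span_X_image]
    exact forall₂_congr fun w _ => h w

/-- Let `I` be minimally generated by the monomials
`u_0, …, u_{m-1}` (pairwise incomparable under divisibility), and let
`I_j = (u_0,…,u_{j-1})`.  Then the ordering `u_0 ≤ ⋯ ≤ u_{m-1}` is a linear
quotients order (each colon ideal `(u_0,…,u_{j-1}) : u_j` is generated by a
subset of the variables) if and only if there are sets of variables
`Z_0,…,Z_{m-1}` such that for each `j` the ideal `I_{j+1}` has the Stanley
decomposition `u_0 K[Z_0] ⊕ ⋯ ⊕ u_j K[Z_j]` (expressed as a partition of its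
set of monomials into the corresponding Stanley sets). -/
theorem stmt_18 {K : Type} [Field K] {n m : ℕ} (u : Fin m → (Fin n →₀ ℕ))
    (hmin : ∀ i j : Fin m, i ≠ j → ¬ u i ≤ u j) :
    (∀ j : Fin m, 0 < j.val → ∃ V : Set (Fin n),
        Submodule.colon
          (Ideal.span ((fun i : Fin m => (monomial (u i) (1 : K) :
            MvPolynomial (Fin n) K)) '' {i | i < j}))
          (Ideal.span {(monomial (u j) (1 : K) : MvPolynomial (Fin n) K)}) =
        Ideal.span ((fun k => (MvPolynomial.X k : MvPolynomial (Fin n) K)) '' V)) ↔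
    (∃ Z : Fin m → Set (Fin n), ∀ j : Fin m,
        (monSet (Ideal.span ((fun i : Fin m => (monomial (u i) (1 : K) :
            MvPolynomial (Fin n) K)) '' {i | i ≤ j})) =
          ⋃ i ∈ {i : Fin m | i ≤ j}, stanleySet (u i) (Z i)) ∧
        (∀ i i' : Fin m, i ≤ j → i' ≤ j → i ≠ i' →
          Disjoint (stanleySet (u i) (Z i)) (stanleySet (u i') (Z i')))) := by
  simp only [colon_monomial_eq_span_X_iff, Set.ext_iff, mem_monSet_span_iff, Set.mem_iUnion,
    Set.mem_ofPred_eq, exists_prop]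
  constructor
  · intro h
    have hV : ∀ j : Fin m, ∃ V : Set (Fin n), ∀ w : Fin n →₀ ℕ,
        (∃ i < j, u i ≤ u j + w) ↔ ∃ k ∈ V, w k ≠ 0 := by
      intro j
      rcases Nat.eq_zero_or_pos j.val with hj | hj
      · refine ⟨∅, fun w => ⟨fun ⟨i, hi, _⟩ => ?_, fun ⟨k, hk, _⟩ => hk.elim⟩⟩
        rw [Fin.lt_def] at hi
        omega
      · exact h j hj
    choose V hV using hV
    have key : ∀ j (x : Fin n →₀ ℕ),
        x ∈ stanleySet (u j) (V j)ᶜ ↔ u j ≤ x ∧ ∀ i < j, ¬ u i ≤ x := by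
      intro j x
      have hadd : ∀ w, u j + w ∈ stanleySet (u j) (V j)ᶜ ↔ ∀ i < j, ¬ u i ≤ u j + w := by
        intro w
        have hw := not_congr (hV j w)
        push Not at hw
        rw [add_mem_stanleySet_iff, hw]
        constructor
        · intro hs k hk
          by_contra hne
          exact hs (Finsupp.mem_support_iff.2 hne) hk
        · intro hs k hk hkV
          exact Finsupp.mem_support_iff.1 hk (hs k hkV)
      constructor
      · intro hx
        obtain ⟨w, rfl⟩ := exists_add_of_le (le_of_mem_stanleySet hx)
        exact ⟨le_self_add, (hadd w).1 hx⟩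
      · rintro ⟨hle, hx⟩
        obtain ⟨w, rfl⟩ := exists_add_of_le hle
        exact (hadd w).2 hx
    refine ⟨fun j => (V j)ᶜ, fun j => ⟨fun x => ⟨?_, ?_⟩, fun i i' _ _ hne => ?_⟩⟩
    · rintro ⟨i, hij, hle⟩
      obtain ⟨l, hl, hleast⟩ := WellFounded.has_min (wellFounded_lt (α := Fin m))
        {i | u i ≤ x} ⟨i, hle⟩
      refine ⟨l, (not_lt.1 (hleast i hle)).trans hij, (key l x).2 ⟨hl, fun k hk hkx => ?_⟩⟩
      exact hleast k hkx hk
    · rintro ⟨i, hij, hx⟩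
      exact ⟨i, hij, le_of_mem_stanleySet hx⟩
    · rw [Set.disjoint_left]
      intro x hx hx'
      rw [key] at hx hx'
      rcases lt_or_gt_of_ne hne with hlt | hlt
      · exact hx'.2 i hlt hx.1
      · exact hx.2 i' hlt hx'.1
  · rintro ⟨Z, hZ⟩ j hj
    refine ⟨(Z j)ᶜ, fun w => ⟨?_, ?_⟩⟩
    · rintro ⟨i, hij, hle⟩
      have hlt : (⟨j.val - 1, by omega⟩ : Fin m) < j := by
        rw [Fin.lt_def]
        exact Nat.sub_one_lt_of_lt hj
      obtain ⟨l, hl, hlw⟩ := ((hZ ⟨j.val - 1, by omega⟩).1 (u j + w)).1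
        ⟨i, Nat.le_sub_one_of_lt hij, hle⟩
      have hlj : l < j := lt_of_le_of_lt hl hlt
      have hnot := Set.disjoint_left.1 ((hZ j).2 l j hlj.le le_rfl hlj.ne) hlw
      rw [add_mem_stanleySet_iff, Set.not_subset] at hnot
      obtain ⟨k, hk, hkZ⟩ := hnot
      exact ⟨k, hkZ, Finsupp.mem_support_iff.1 hk⟩
    · rintro ⟨k, hkZ, hk⟩
      obtain ⟨i, hij, hx⟩ := ((hZ j).1 (u j + w)).1 ⟨j, le_rfl, le_self_add⟩
      refine ⟨i, lt_of_le_of_ne hij ?_, le_of_mem_stanleySet hx⟩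
      rintro rfl
      exact hkZ ((add_mem_stanleySet_iff _ _ _).1 hx (Finsupp.mem_support_iff.2 hk))
end
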